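/- For w ∈ W acting on variables by (σ_i(x))_j = q^{-1}x_i^{-1} if j=i, q^{1/2}x_ix_j if i∼j, x_j otherwise, the Weyl denominator Δ(x) = Π_{α∈Φ⁺}(1 - q^{ht(α)} x^{2α}) satisfies Δ(w(x)) = (Π_{α∈Φ(w)} -q^{-ht(α)} x^{-2α}) · Δ(x), as an identity of formal series. -/

import Mathlib

/-- The simple reflection `σ_i` acting on the root lattice. -/
def reflZ {m : ℕ} (G : SimpleGraph (Fin m)) [DecidableRel G.Adj] (i : Fin m)
    (v : Fin m → ℤ) : Fin m → ℤ :=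
  fun k => if k = i then -v i + ∑ j ∈ Finset.univ.filter (fun j => G.Adj i j), v j else v k

/-- The set `Φ` of real roots: the orbit of the simple roots under the Weyl group. -/
def realRoots {m : ℕ} (G : SimpleGraph (Fin m)) [DecidableRel G.Adj] :
    Set (Fin m → ℤ) :=
  {α | ∃ (l : List (Fin m)) (i : Fin m),
    α = l.foldr (fun j v => reflZ G j v) (Pi.single i 1)}

/-- The action of the word `σ_{i_1} ⋯ σ_{i_ℓ}` on the root lattice. -/
def weylWord {m : ℕ} (G : SimpleGraph (Fin m)) [DecidableRel G.Adj] (l : List (Fin m)) :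
    (Fin m → ℤ) → (Fin m → ℤ) :=
  l.foldr (fun i f => reflZ G i ∘ f) id

/-- The transformation `σ_i` on the variables:
`(σ_i(x))_j = q⁻¹x_i⁻¹` if `j = i`, `q^{1/2}x_ix_j` if `i ∼ j`, `x_j` otherwise. -/
noncomputable def varAct {m : ℕ} (G : SimpleGraph (Fin m)) [DecidableRel G.Adj] (q : ℝ)
    (i : Fin m) (x : Fin m → ℂ) : Fin m → ℂ :=
  fun j => if j = i then ((q : ℂ) * x i)⁻¹
    else if G.Adj i j then (Real.sqrt q : ℂ) * x i * x j else x j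

/-- The action of the word `σ_{i_1} ⋯ σ_{i_ℓ}` on the variables. -/
noncomputable def varWord {m : ℕ} (G : SimpleGraph (Fin m)) [DecidableRel G.Adj] (q : ℝ)
    (l : List (Fin m)) (x : Fin m → ℂ) : Fin m → ℂ :=
  l.foldr (fun i y => varAct G q i y) x

/-- The finite set `Φ⁺` of positive roots of a finite root system. -/
noncomputable def posRootFinset {m : ℕ} (G : SimpleGraph (Fin m)) [DecidableRel G.Adj]
    (hfin : (realRoots G).Finite) : Finset (Fin m → ℤ) :=
  letI := Classical.decPred fun α : Fin m → ℤ => 0 ≤ α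
  hfin.toFinset.filter fun α => 0 ≤ α

/-- The inversion set `Φ(w) = Φ⁺ ∩ w⁻¹(Φ⁻)` of the word `w = σ_{i_1} ⋯ σ_{i_ℓ}`. -/
noncomputable def invRootFinset {m : ℕ} (G : SimpleGraph (Fin m)) [DecidableRel G.Adj]
    (hfin : (realRoots G).Finite) (l : List (Fin m)) : Finset (Fin m → ℤ) :=
  letI := Classical.decPred fun α : Fin m → ℤ =>
    weylWord G l α ∈ realRoots G ∧ weylWord G l α ≤ 0
  (posRootFinset G hfin).filter fun α =>
    weylWord G l α ∈ realRoots G ∧ weylWord G l α ≤ 0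

/-- The pairing `⟨v, α_i^∨⟩` of a vector with the `i`-th simple coroot. -/
def corootPairing {m : ℕ} (G : SimpleGraph (Fin m)) [DecidableRel G.Adj] (i : Fin m)
    (v : Fin m → ℤ) : ℤ :=
  2 * v i - ∑ j ∈ Finset.univ.filter (fun j => G.Adj i j), v j

section RootLattice

variable {m : ℕ} (G : SimpleGraph (Fin m)) [DecidableRel G.Adj]

theorem reflZ_eq_sub (i : Fin m) (v : Fin m → ℤ) :
    reflZ G i v = v - corootPairing G i v • Pi.single i 1 := by
  funext k
  by_cases hk : k = i
  · subst hk
    simp [reflZ, corootPairing]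
    ring
  · simp [reflZ, hk]

/-- The simple reflection as a linear endomorphism of the root lattice. -/
def reflLin (i : Fin m) : Module.End ℤ (Fin m → ℤ) where
  toFun := reflZ G i
  map_add' u v := by
    funext k
    by_cases hk : k = i
    · simp [reflZ, hk, Finset.sum_add_distrib]
      ring
    · simp [reflZ, hk]
  map_smul' c v := by
    funext k
    by_cases hk : k = i
    · simp [reflZ, hk, Finset.mul_sum, mul_add]
    · simp [reflZ, hk]

@[simp]
theorem reflLin_apply (i : Fin m) (v : Fin m → ℤ) : reflLin G i v = reflZ G i v := rfl

theorem corootPairing_single_self (i : Fin m) :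
    corootPairing G i (Pi.single i 1) = 2 := by
  have : ∑ j ∈ Finset.univ.filter (fun j => G.Adj i j), (Pi.single i 1 : Fin m → ℤ) j = 0 := by
    refine Finset.sum_eq_zero fun j hj => ?_
    have hij : G.Adj i j := by simpa using hj
    simp [hij.ne']
  simp [corootPairing, this]

theorem corootPairing_single_of_adj {i j : Fin m} (h : G.Adj i j) :
    corootPairing G i (Pi.single j 1) = -1 := by
  simp [corootPairing, Pi.single_apply, h.ne, h]

theorem reflZ_single_self (i : Fin m) : reflZ G i (Pi.single i 1) = -Pi.single i 1 := by
  rw [reflZ_eq_sub, corootPairing_single_self]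
  module

theorem reflLin_mul_self (i : Fin m) : reflLin G i * reflLin G i = 1 := by
  refine LinearMap.ext fun v => ?_
  change reflLin G i (reflLin G i v) = v
  rw [reflLin_apply G i v, reflZ_eq_sub, map_sub, map_smul, reflLin_apply, reflLin_apply,
    reflZ_single_self, reflZ_eq_sub]
  module

/-- The Weyl group element of a word as a linear endomorphism of the root lattice. -/
def wordLin (l : List (Fin m)) : Module.End ℤ (Fin m → ℤ) := (l.map (reflLin G)).prod

@[simp]
theorem wordLin_nil : wordLin G [] = 1 := rfl

@[simp]
theorem wordLin_cons (i : Fin m) (l : List (Fin m)) :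
    wordLin G (i :: l) = reflLin G i * wordLin G l := by
  simp [wordLin]

theorem wordLin_append (l l' : List (Fin m)) :
    wordLin G (l ++ l') = wordLin G l * wordLin G l' := by
  simp [wordLin]

theorem wordLin_mul_reverse (l : List (Fin m)) : wordLin G l * wordLin G l.reverse = 1 := by
  induction l with
  | nil => simp
  | cons i l ih =>
    rw [List.reverse_cons, wordLin_append, wordLin_cons, wordLin_cons, wordLin_nil, mul_one,
      mul_assoc, ← mul_assoc (wordLin G l), ih, one_mul, reflLin_mul_self]

theorem wordLin_apply_reverse (l : List (Fin m)) (v : Fin m → ℤ) :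
    wordLin G l (wordLin G l.reverse v) = v :=
  LinearMap.congr_fun (wordLin_mul_reverse G l) v

theorem wordLin_reverse_apply (l : List (Fin m)) (v : Fin m → ℤ) :
    wordLin G l.reverse (wordLin G l v) = v := by
  simpa using wordLin_apply_reverse G l.reverse v

theorem weylWord_eq_wordLin (l : List (Fin m)) (v : Fin m → ℤ) :
    weylWord G l v = wordLin G l v := by
  induction l with
  | nil => rfl
  | cons i l ih =>
    change reflZ G i (weylWord G l v) = _
    rw [ih, wordLin_cons]
    rfl

theorem foldr_reflZ_eq_wordLin (l : List (Fin m)) (v : Fin m → ℤ) :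
    l.foldr (fun j v => reflZ G j v) v = wordLin G l v := by
  induction l with
  | nil => rfl
  | cons i l ih =>
    rw [List.foldr_cons, ih, wordLin_cons]
    rfl

theorem mem_realRoots_iff {α : Fin m → ℤ} :
    α ∈ realRoots G ↔ ∃ (l : List (Fin m)) (i : Fin m), α = wordLin G l (Pi.single i 1) := by
  simp only [realRoots, Set.mem_ofPred_eq, foldr_reflZ_eq_wordLin]

theorem wordLin_single_mem_realRoots (l : List (Fin m)) (i : Fin m) :
    wordLin G l (Pi.single i 1) ∈ realRoots G :=
  (mem_realRoots_iff G).2 ⟨l, i, rfl⟩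

variable {G}

theorem wordLin_mem_realRoots (l : List (Fin m)) {α : Fin m → ℤ} (hα : α ∈ realRoots G) :
    wordLin G l α ∈ realRoots G := by
  obtain ⟨l', i, rfl⟩ := (mem_realRoots_iff G).1 hα
  refine (mem_realRoots_iff G).2 ⟨l ++ l', i, ?_⟩
  rw [wordLin_append]
  rfl

theorem neg_mem_realRoots {α : Fin m → ℤ} (hα : α ∈ realRoots G) : -α ∈ realRoots G := by
  obtain ⟨l, i, rfl⟩ := (mem_realRoots_iff G).1 hα
  refine (mem_realRoots_iff G).2 ⟨l ++ [i], i, ?_⟩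
  rw [wordLin_append, wordLin_cons, wordLin_nil, mul_one, Module.End.mul_apply, reflLin_apply,
    reflZ_single_self, map_neg]

theorem ne_zero_of_mem_realRoots {α : Fin m → ℤ} (hα : α ∈ realRoots G) : α ≠ 0 := by
  obtain ⟨l, i, rfl⟩ := (mem_realRoots_iff G).1 hα
  intro h
  have h' := congrArg (wordLin G l.reverse) h
  rw [wordLin_reverse_apply, map_zero] at h'
  simpa using congrFun h' i

theorem finite_range_wordLin (hfin : (realRoots G).Finite) : (Set.range (wordLin G)).Finite := by
  have hpi : (Set.univ.pi fun _ : Fin m => realRoots G).Finite := Set.Finite.pi fun _ => hfin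
  refine Set.Finite.of_finite_image (f := fun f i => f (Pi.single i 1)) (hpi.subset ?_) ?_
  · rintro _ ⟨_, ⟨l, rfl⟩, rfl⟩ i -
    exact wordLin_single_mem_realRoots G l i
  · intro f _ g _ hfg
    refine LinearMap.pi_ext' fun i => LinearMap.ext_ring ?_
    simpa using congrFun hfg i

theorem even_sum_mul_corootPairing (v : Fin m → ℤ) :
    Even (∑ i, v i * corootPairing G i v) := by
  have hodd : Even (∑ i, ∑ j, if G.Adj i j then v i * v j else 0) := by
    rw [← ZMod.intCast_eq_zero_iff_even]
    rw [← Finset.sum_product', Int.cast_sum]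
    refine Finset.sum_involution (fun p _ => p.swap) ?_ ?_ (by simp) (by simp)
    · rintro ⟨i, j⟩ -
      simp only [Prod.swap, G.adj_comm j i, mul_comm (v j)]
      exact CharTwo.add_self_eq_zero _
    · rintro ⟨i, j⟩ - h heq
      have : j = i := congrArg Prod.fst heq
      subst this
      simp at h
  have : ∑ i, v i * corootPairing G i v =
      2 * (∑ i, v i * v i) - ∑ i, ∑ j, if G.Adj i j then v i * v j else 0 := by
    rw [Finset.mul_sum, ← Finset.sum_sub_distrib]
    refine Finset.sum_congr rfl fun i _ => ?_
    rw [corootPairing, Finset.sum_filter, mul_sub, Finset.mul_sum]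
    simp only [mul_ite, mul_zero]
    ring
  rw [this]
  exact (even_two_mul _).sub hodd

/-- The Weyl-invariant form on the root lattice obtained by averaging the standard one. -/
noncomputable def invForm (hfin : (realRoots G).Finite) (u v : Fin m → ℤ) : ℤ :=
  ∑ f ∈ (finite_range_wordLin hfin).toFinset, f u ⬝ᵥ f v

section InvForm

variable (hfin : (realRoots G).Finite)

theorem invForm_comm (u v : Fin m → ℤ) : invForm hfin u v = invForm hfin v u :=
  Finset.sum_congr rfl fun _ _ => dotProduct_comm _ _

theorem invForm_smul_right (c : ℤ) (u v : Fin m → ℤ) :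
    invForm hfin u (c • v) = c * invForm hfin u v := by
  simp only [invForm, map_smul, dotProduct_smul, Finset.mul_sum, smul_eq_mul]

theorem invForm_sub_right (u v w : Fin m → ℤ) :
    invForm hfin u (v - w) = invForm hfin u v - invForm hfin u w := by
  simp [invForm, Finset.sum_sub_distrib]

theorem invForm_eq_sum (u v : Fin m → ℤ) :
    invForm hfin u v = ∑ i, v i * invForm hfin u (Pi.single i 1) := by
  simp only [invForm, Finset.mul_sum]
  rw [Finset.sum_comm]
  refine Finset.sum_congr rfl fun f _ => ?_
  conv_lhs => rw [pi_eq_sum_univ' v]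
  rw [map_sum, dotProduct_sum]
  refine Finset.sum_congr rfl fun i _ => ?_
  rw [map_smul, dotProduct_smul, smul_eq_mul]

theorem invForm_self_pos {v : Fin m → ℤ} (hv : v ≠ 0) : 0 < invForm hfin v v := by
  refine Finset.sum_pos' (fun f _ => ?_) ⟨1, ?_, ?_⟩
  · exact Finset.sum_nonneg fun i _ => mul_self_nonneg _
  · exact (finite_range_wordLin hfin).mem_toFinset.2 ⟨[], rfl⟩
  · have h0 : 0 ≤ v ⬝ᵥ v := Finset.sum_nonneg fun i _ => mul_self_nonneg _
    exact lt_of_le_of_ne h0 fun h => hv (dotProduct_self_eq_zero.1 h.symm)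

theorem invForm_reflZ (i : Fin m) (u v : Fin m → ℤ) :
    invForm hfin (reflZ G i u) (reflZ G i v) = invForm hfin u v := by
  have hmem : ∀ f ∈ (finite_range_wordLin hfin).toFinset,
      f * reflLin G i ∈ (finite_range_wordLin hfin).toFinset := by
    intro f hf
    obtain ⟨l, rfl⟩ := (finite_range_wordLin hfin).mem_toFinset.1 hf
    exact (finite_range_wordLin hfin).mem_toFinset.2 ⟨l ++ [i], by simp [wordLin_append]⟩
  refine Finset.sum_bij' (fun f _ => f * reflLin G i) (fun f _ => f * reflLin G i) hmem hmem
    ?_ ?_ ?_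
  · intro f _
    rw [mul_assoc, reflLin_mul_self, mul_one]
  · intro f _
    rw [mul_assoc, reflLin_mul_self, mul_one]
  · intro f _
    rfl

theorem invForm_wordLin (l : List (Fin m)) (u v : Fin m → ℤ) :
    invForm hfin (wordLin G l u) (wordLin G l v) = invForm hfin u v := by
  induction l with
  | nil => rfl
  | cons i l ih =>
    rw [wordLin_cons, ← ih]
    exact invForm_reflZ hfin i _ _

theorem two_mul_invForm_single (i : Fin m) (v : Fin m → ℤ) :
    2 * invForm hfin v (Pi.single i 1) =
      corootPairing G i v * invForm hfin (Pi.single i 1) (Pi.single i 1) := by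
  have h := invForm_reflZ hfin i (Pi.single i 1) v
  rw [reflZ_single_self, reflZ_eq_sub, invForm_sub_right, invForm_smul_right] at h
  have hneg : ∀ u w : Fin m → ℤ, invForm hfin (-u) w = -invForm hfin u w := by
    intro u w
    simp [invForm]
  rw [hneg, hneg] at h
  rw [invForm_comm]
  linarith

theorem invForm_single_eq_of_adj {i j : Fin m} (h : G.Adj i j) :
    invForm hfin (Pi.single i 1) (Pi.single i 1) =
      invForm hfin (Pi.single j 1) (Pi.single j 1) := by
  have hi := two_mul_invForm_single hfin i (Pi.single j 1)
  have hj := two_mul_invForm_single hfin j (Pi.single i 1)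
  rw [corootPairing_single_of_adj G h] at hi
  rw [corootPairing_single_of_adj G h.symm, invForm_comm] at hj
  linarith

theorem invForm_single_eq_of_wordLin_ne_zero (l : List (Fin m)) (k i : Fin m)
    (hi : wordLin G l (Pi.single k 1) i ≠ 0) :
    invForm hfin (Pi.single i 1) (Pi.single i 1) =
      invForm hfin (Pi.single k 1) (Pi.single k 1) := by
  induction l generalizing i with
  | nil =>
    by_cases hik : i = k
    · rw [hik]
    · simp [hik] at hi
  | cons j l ih =>
    rw [wordLin_cons, Module.End.mul_apply, reflLin_apply, reflZ] at hi
    split_ifs at hi with hij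
    · subst hij
      by_cases h0 : wordLin G l (Pi.single k 1) i = 0
      · rw [h0, neg_zero, zero_add] at hi
        obtain ⟨j, hj, hj0⟩ := Finset.exists_ne_zero_of_sum_ne_zero hi
        rw [← ih j hj0]
        exact invForm_single_eq_of_adj hfin (by simpa using hj)
      · exact ih i h0
    · exact ih i hi

theorem two_mul_invForm_self {d : ℤ} {v : Fin m → ℤ}
    (hv : ∀ i, v i ≠ 0 → invForm hfin (Pi.single i 1) (Pi.single i 1) = d) :
    2 * invForm hfin v v = d * ∑ i, v i * corootPairing G i v := by
  rw [invForm_eq_sum, Finset.mul_sum, Finset.mul_sum]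
  refine Finset.sum_congr rfl fun i _ => ?_
  by_cases h0 : v i = 0
  · simp [h0]
  · rw [← hv i h0]
    linear_combination v i * two_mul_invForm_single hfin i v

/-- A nonzero vector supported on simple roots of norm `d` has norm at least `d`. -/
theorem le_invForm_self {d : ℤ} (hd : 0 < d) {v : Fin m → ℤ} (hv0 : v ≠ 0)
    (hv : ∀ i, v i ≠ 0 → invForm hfin (Pi.single i 1) (Pi.single i 1) = d) :
    d ≤ invForm hfin v v := by
  have h := two_mul_invForm_self hfin hv
  obtain ⟨t, ht⟩ := even_sum_mul_corootPairing (G := G) v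
  have hpos := invForm_self_pos hfin hv0
  rw [ht] at h
  have ht1 : 1 ≤ t := by
    by_contra! hlt
    nlinarith
  nlinarith

theorem invForm_nonpos_of_disjoint {u v : Fin m → ℤ} (hu : 0 ≤ u) (hv : 0 ≤ v)
    (huv : ∀ i, v i ≠ 0 → u i = 0) : invForm hfin u v ≤ 0 := by
  rw [invForm_eq_sum]
  refine Finset.sum_nonpos fun i _ => ?_
  by_cases h0 : v i = 0
  · simp [h0]
  · refine mul_nonpos_of_nonneg_of_nonpos (hv i) ?_
    have h := two_mul_invForm_single hfin i u
    have hc : corootPairing G i u ≤ 0 := by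
      rw [corootPairing, huv i h0]
      have : 0 ≤ ∑ j ∈ Finset.univ.filter (fun j => G.Adj i j), u j :=
        Finset.sum_nonneg fun j _ => hu j
      linarith
    have hp : 0 < invForm hfin (Pi.single i 1) (Pi.single i 1) :=
      invForm_self_pos hfin (by simp)
    nlinarith

end InvForm

/-- Every root of a finite simply-laced root system is positive or negative. -/
theorem nonneg_or_nonpos_of_mem_realRoots (hfin : (realRoots G).Finite) {α : Fin m → ℤ}
    (hα : α ∈ realRoots G) : 0 ≤ α ∨ α ≤ 0 := by
  obtain ⟨l, k, hlk⟩ := (mem_realRoots_iff G).1 hα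
  have hd : 0 < invForm hfin (Pi.single k 1) (Pi.single k 1) := invForm_self_pos hfin (by simp)
  have hsupp : ∀ i, α i ≠ 0 → invForm hfin (Pi.single i 1) (Pi.single i 1) =
      invForm hfin (Pi.single k 1) (Pi.single k 1) := by
    subst hlk
    exact invForm_single_eq_of_wordLin_ne_zero hfin l k
  have hnorm : invForm hfin α α = invForm hfin (Pi.single k 1) (Pi.single k 1) := by
    rw [hlk, invForm_wordLin]
  by_contra! hcon
  obtain ⟨h1, h2⟩ := hcon
  have hpos_apply : ∀ i, α⁺ i = max (α i) 0 := fun i => rfl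
  have hneg_apply : ∀ i, α⁻ i = max (-α i) 0 := fun i => rfl
  have hp := le_invForm_self hfin hd (v := α⁺) (fun h => h2 (posPart_eq_zero.1 h))
    fun i hi => hsupp i fun h => hi (by simp [hpos_apply, h])
  have hn := le_invForm_self hfin hd (v := α⁻) (fun h => h1 (negPart_eq_zero.1 h))
    fun i hi => hsupp i fun h => hi (by simp [hneg_apply, h])
  have hpn : invForm hfin α⁺ α⁻ ≤ 0 := by
    refine invForm_nonpos_of_disjoint hfin (posPart_nonneg α) (negPart_nonneg α) fun i hi => ?_
    rw [hneg_apply] at hi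
    rw [hpos_apply]
    omega
  have hexp : invForm hfin (α⁺ - α⁻) (α⁺ - α⁻) =
      invForm hfin α⁺ α⁺ + invForm hfin α⁻ α⁻ - 2 * invForm hfin α⁺ α⁻ := by
    rw [invForm_sub_right, invForm_comm hfin (α⁺ - α⁻), invForm_comm hfin (α⁺ - α⁻),
      invForm_sub_right, invForm_sub_right, invForm_comm hfin α⁻ α⁺]
    ring
  rw [posPart_sub_negPart, hnorm] at hexp
  linarith

theorem mem_posRootFinset (hfin : (realRoots G).Finite) {α : Fin m → ℤ} :
    α ∈ posRootFinset G hfin ↔ α ∈ realRoots G ∧ 0 ≤ α := by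
  simp [posRootFinset]

end RootLattice

/-- The monomial `q^{ht(α)} x^{2α}`. -/
noncomputable def rootMonomial {m : ℕ} (q : ℝ) (x : Fin m → ℂ) (α : Fin m → ℤ) : ℂ :=
  (q : ℂ) ^ (∑ j, α j) * ∏ j, x j ^ (2 * α j)

section Monomial

variable {m : ℕ} {q : ℝ}

theorem rootMonomial_eq_prod (hq : 0 < q) (x : Fin m → ℂ) (α : Fin m → ℤ) :
    rootMonomial q x α = ∏ j, ((q : ℂ) * x j ^ 2) ^ α j := by
  have hq' : (q : ℂ) ≠ 0 := by exact_mod_cast hq.ne'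
  have hsum : (q : ℂ) ^ (∑ j, α j) = ∏ j, (q : ℂ) ^ α j := by
    induction (Finset.univ : Finset (Fin m)) using Finset.induction_on with
    | empty => simp
    | insert a s ha ih => rw [Finset.sum_insert ha, Finset.prod_insert ha, zpow_add₀ hq', ih]
  rw [rootMonomial, hsum, ← Finset.prod_mul_distrib]
  refine Finset.prod_congr rfl fun j _ => ?_
  rw [mul_zpow, zpow_mul]
  norm_cast

theorem rootMonomial_neg (x : Fin m → ℂ) (α : Fin m → ℤ) :
    rootMonomial q x (-α) = (rootMonomial q x α)⁻¹ := by
  simp [rootMonomial, Finset.sum_neg_distrib, zpow_neg, mul_comm]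

theorem rootMonomial_ne_zero (hq : 0 < q) {x : Fin m → ℂ} (hx : ∀ j, x j ≠ 0)
    (α : Fin m → ℤ) : rootMonomial q x α ≠ 0 := by
  have hq' : (q : ℂ) ≠ 0 := by exact_mod_cast hq.ne'
  exact mul_ne_zero (zpow_ne_zero _ hq')
    (Finset.prod_ne_zero_iff.2 fun j _ => zpow_ne_zero _ (hx j))

variable (G : SimpleGraph (Fin m)) [DecidableRel G.Adj]

theorem varAct_ne_zero (hq : 0 < q) {x : Fin m → ℂ} (hx : ∀ j, x j ≠ 0) (i j : Fin m) :
    varAct G q i x j ≠ 0 := by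
  have hq' : (q : ℂ) ≠ 0 := by exact_mod_cast hq.ne'
  have hs : (Real.sqrt q : ℂ) ≠ 0 := by exact_mod_cast (Real.sqrt_pos.2 hq).ne'
  rw [varAct]
  split_ifs
  · exact inv_ne_zero (mul_ne_zero hq' (hx i))
  · exact mul_ne_zero (mul_ne_zero hs (hx i)) (hx j)
  · exact hx j

theorem varWord_ne_zero (hq : 0 < q) {x : Fin m → ℂ} (hx : ∀ j, x j ≠ 0)
    (l : List (Fin m)) (j : Fin m) : varWord G q l x j ≠ 0 := by
  induction l generalizing j with
  | nil => exact hx j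
  | cons i l ih => exact varAct_ne_zero G hq ih i j

theorem rootMonomial_varAct (hq : 0 < q) {x : Fin m → ℂ} (hx : ∀ j, x j ≠ 0) (i : Fin m)
    (α : Fin m → ℤ) : rootMonomial q (varAct G q i x) α = rootMonomial q x (reflZ G i α) := by
  have hq' : (q : ℂ) ≠ 0 := by exact_mod_cast hq.ne'
  have hs : (Real.sqrt q : ℂ) ^ 2 = q := by exact_mod_cast Real.sq_sqrt hq.le
  have hy : ∀ j, (q : ℂ) * x j ^ 2 ≠ 0 := fun j => mul_ne_zero hq' (pow_ne_zero _ (hx j))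
  rw [rootMonomial_eq_prod hq, rootMonomial_eq_prod hq,
    ← Finset.mul_prod_erase _ _ (Finset.mem_univ i),
    ← Finset.mul_prod_erase (a := i) _ (fun j => ((q : ℂ) * x j ^ 2) ^ reflZ G i α j)
      (Finset.mem_univ i)]
  have hi : ((q : ℂ) * varAct G q i x i ^ 2) ^ α i = ((q : ℂ) * x i ^ 2) ^ (-α i) := by
    rw [zpow_neg, ← inv_zpow]
    congr 1
    simp only [varAct, if_true]
    field_simp [hx i]
  have hoff : ∀ j ∈ Finset.univ.erase i, ((q : ℂ) * varAct G q i x j ^ 2) ^ α j =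
      ((q : ℂ) * x i ^ 2) ^ (if G.Adj i j then α j else 0) * ((q : ℂ) * x j ^ 2) ^ α j := by
    intro j hj
    have hji : j ≠ i := Finset.ne_of_mem_erase hj
    by_cases hadj : G.Adj i j
    · rw [if_pos hadj, ← mul_zpow]
      congr 1
      simp only [varAct, if_neg hji, if_pos hadj]
      rw [mul_pow, mul_pow, hs]
      ring
    · simp [varAct, hji, hadj]
  have hsum : ∏ j ∈ Finset.univ.erase i,
      ((q : ℂ) * x i ^ 2) ^ (if G.Adj i j then α j else 0) =
      ((q : ℂ) * x i ^ 2) ^ (∑ j ∈ Finset.univ.filter (fun j => G.Adj i j), α j) := by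
    rw [Finset.sum_filter, ← Finset.add_sum_erase _ _ (Finset.mem_univ i), if_neg (G.irrefl),
      zero_add]
    induction (Finset.univ.erase i : Finset (Fin m)) using Finset.induction_on with
    | empty => simp
    | insert a s ha ih => rw [Finset.sum_insert ha, Finset.prod_insert ha, zpow_add₀ (hy i), ih]
  rw [hi, Finset.prod_congr rfl hoff, Finset.prod_mul_distrib, hsum, ← mul_assoc,
    ← zpow_add₀ (hy i)]
  congr 1
  · simp [reflZ]
  · refine Finset.prod_congr rfl fun j hj => ?_
    simp [reflZ, Finset.ne_of_mem_erase hj]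

theorem rootMonomial_varWord (hq : 0 < q) {x : Fin m → ℂ} (hx : ∀ j, x j ≠ 0)
    (l : List (Fin m)) (α : Fin m → ℤ) :
    rootMonomial q (varWord G q l x) α = rootMonomial q x (wordLin G l.reverse α) := by
  induction l generalizing α with
  | nil => rfl
  | cons i l ih =>
    rw [List.reverse_cons, wordLin_append, wordLin_cons, wordLin_nil, mul_one,
      Module.End.mul_apply, reflLin_apply, ← ih]
    exact rootMonomial_varAct G hq (varWord_ne_zero G hq hx l) i α

end Monomial

section PositivePermutation

variable {m : ℕ} {G : SimpleGraph (Fin m)} [DecidableRel G.Adj]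

open Classical in
/-- The positive one of the two roots `±wα`. -/
noncomputable def posWord (G : SimpleGraph (Fin m)) [DecidableRel G.Adj] (l : List (Fin m))
    (α : Fin m → ℤ) : Fin m → ℤ :=
  if 0 ≤ wordLin G l α then wordLin G l α else -wordLin G l α

theorem posWord_mem (hfin : (realRoots G).Finite) (l : List (Fin m)) {α : Fin m → ℤ}
    (hα : α ∈ posRootFinset G hfin) : posWord G l α ∈ posRootFinset G hfin := by
  rw [mem_posRootFinset] at hα ⊢
  have hw := wordLin_mem_realRoots l hα.1
  rw [posWord]
  split_ifs with h
  · exact ⟨hw, h⟩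
  · exact ⟨neg_mem_realRoots hw,
      neg_nonneg.2 ((nonneg_or_nonpos_of_mem_realRoots hfin hw).resolve_left h)⟩

theorem not_nonneg_neg (hfin : (realRoots G).Finite) {α : Fin m → ℤ}
    (hα : α ∈ posRootFinset G hfin) : ¬ 0 ≤ -α := by
  rw [mem_posRootFinset] at hα
  exact fun h => ne_zero_of_mem_realRoots hα.1 (le_antisymm (neg_nonneg.1 h) hα.2)

theorem posWord_posWord_reverse (hfin : (realRoots G).Finite) (l : List (Fin m))
    {α : Fin m → ℤ} (hα : α ∈ posRootFinset G hfin) :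
    posWord G l (posWord G l.reverse α) = α := by
  have h0 := ((mem_posRootFinset hfin).1 hα).2
  by_cases h : 0 ≤ wordLin G l.reverse α
  · have : posWord G l.reverse α = wordLin G l.reverse α := if_pos h
    rw [this, posWord, wordLin_apply_reverse, if_pos h0]
  · have : posWord G l.reverse α = -wordLin G l.reverse α := if_neg h
    rw [this, posWord, map_neg, wordLin_apply_reverse, if_neg (not_nonneg_neg hfin hα), neg_neg]

end PositivePermutation

/-- The Weyl denominator `Δ(x) = Π_{α∈Φ⁺}(1 - q^{ht(α)} x^{2α})` of a finite simply-laced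
root system satisfies `Δ(w(x)) = (Π_{α∈Φ(w)} -q^{-ht(α)} x^{-2α}) · Δ(x)`. -/
theorem weyl_denominator_transformation {m : ℕ} (G : SimpleGraph (Fin m))
    [DecidableRel G.Adj] (hfin : (realRoots G).Finite) (q : ℝ) (hq : 0 < q)
    (l : List (Fin m)) (x : Fin m → ℂ) (hx : ∀ j, x j ≠ 0) :
    (∏ α ∈ posRootFinset G hfin,
        (1 - (q : ℂ) ^ (∑ j, α j) * ∏ j, varWord G q l x j ^ (2 * α j))) =
      (∏ α ∈ invRootFinset G hfin l,
          -((q : ℂ) ^ (-(∑ j, α j)) * ∏ j, x j ^ (-(2 * α j)))) *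
        ∏ α ∈ posRootFinset G hfin,
          (1 - (q : ℂ) ^ (∑ j, α j) * ∏ j, x j ^ (2 * α j)) := by
  classical
  change ∏ α ∈ posRootFinset G hfin, (1 - rootMonomial q (varWord G q l x) α) =
    _ * ∏ α ∈ posRootFinset G hfin, (1 - rootMonomial q x α)
  have hfactor : ∀ α : Fin m → ℤ,
      -((q : ℂ) ^ (-(∑ j, α j)) * ∏ j, x j ^ (-(2 * α j))) = -(rootMonomial q x α)⁻¹ := by
    intro α
    rw [← rootMonomial_neg]
    simp [rootMonomial, Finset.sum_neg_distrib]
  simp only [hfactor, invRootFinset, weylWord_eq_wordLin]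
  rw [Finset.prod_filter, ← Finset.prod_mul_distrib]
  refine Finset.prod_bij' (fun α _ => posWord G l.reverse α) (fun α _ => posWord G l α)
    (fun α hα => posWord_mem hfin _ hα) (fun α hα => posWord_mem hfin _ hα)
    (fun α hα => posWord_posWord_reverse hfin l hα)
    (fun α hα => by simpa using posWord_posWord_reverse hfin l.reverse hα) fun α hα => ?_
  rw [rootMonomial_varWord G hq hx]
  obtain ⟨hroot, h0⟩ := (mem_posRootFinset hfin).1 hα
  by_cases h : 0 ≤ wordLin G l.reverse α
  · have hpos : posWord G l.reverse α = wordLin G l.reverse α := if_pos h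
    have hnot : ¬ (α ∈ realRoots G ∧ α ≤ 0) := fun h' =>
      not_nonneg_neg hfin hα (neg_nonneg.2 h'.2)
    rw [hpos, wordLin_apply_reverse, if_neg hnot, one_mul]
  · have hneg : posWord G l.reverse α = -wordLin G l.reverse α := if_neg h
    rw [hneg, map_neg, wordLin_apply_reverse,
      if_pos ⟨neg_mem_realRoots hroot, neg_nonpos.2 h0⟩, rootMonomial_neg]
    have hne := rootMonomial_ne_zero hq hx (wordLin G l.reverse α)
    field_simp
    ring
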